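/- Under the attacked-network setup, let i, i′ be two neuron indices with b_i < b_{i′}, and suppose the slice A_{i′} \ A_i contains exactly one sample index j*, with r_{j*} ≠ 0. Then the slice scalar β = (1/g_{i′}) · (∂ L / ∂ b_{i′}) − (1/g_i) · (∂ L / ∂ b_i) is nonzero, and dividing the slice vector by it exactly reconstructs the isolated input: [(1/g_{i′}) · ∇_{W_{i′}} L − (1/g_i) · ∇_{W_i} L] / β = x_{j*}. -/

import Mathlib

open scoped RealInnerProductSpace BigOperators

noncomputable section

/-- Output of the attacked network: `F(W, b; x) = ∑ i, g i * max (⟪W i, x⟫ + b i) 0 + c`. -/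
def netF {d N : ℕ} (g : Fin N → ℝ) (c : ℝ)
    (W : Fin N → EuclideanSpace ℝ (Fin d)) (b : Fin N → ℝ)
    (x : EuclideanSpace ℝ (Fin d)) : ℝ :=
  (∑ i, g i * max (⟪W i, x⟫ + b i) 0) + c

/-- Batch loss `L(W, b) = (1/B) ∑ j, ℓ j (F(W, b; x j))`. -/
def batchLoss {d B N : ℕ} (ℓ : Fin B → ℝ → ℝ) (g : Fin N → ℝ) (c : ℝ)
    (x : Fin B → EuclideanSpace ℝ (Fin d))
    (W : Fin N → EuclideanSpace ℝ (Fin d)) (b : Fin N → ℝ) : ℝ :=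
  (1 / (B : ℝ)) * ∑ j, ℓ j (netF g c W b (x j))

/-- Residual `r j = ℓ j ′ (F(w, b; x j))`, at the point where all weight rows equal `w`. -/
def sResidual {d B N : ℕ} (ℓ : Fin B → ℝ → ℝ) (g : Fin N → ℝ) (c : ℝ)
    (x : Fin B → EuclideanSpace ℝ (Fin d)) (w : EuclideanSpace ℝ (Fin d))
    (b : Fin N → ℝ) (j : Fin B) : ℝ :=
  deriv (ℓ j) (netF g c (fun _ => w) b (x j))

/-- Active set `A i = {j : ⟪w, x j⟫ + b i > 0}`. -/
def activeSet {d B N : ℕ} (x : Fin B → EuclideanSpace ℝ (Fin d))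
    (w : EuclideanSpace ℝ (Fin d)) (b : Fin N → ℝ) (i : Fin N) : Finset (Fin B) :=
  Finset.univ.filter fun j => 0 < ⟪w, x j⟫ + b i

/-- Gradient of the batch loss with respect to the `i`-th weight row, at the evaluation
point where all weight rows equal `w`. -/
def gradW {d B N : ℕ} (ℓ : Fin B → ℝ → ℝ) (g : Fin N → ℝ) (c : ℝ)
    (x : Fin B → EuclideanSpace ℝ (Fin d)) (w : EuclideanSpace ℝ (Fin d))
    (b : Fin N → ℝ) (i : Fin N) : EuclideanSpace ℝ (Fin d) :=
  gradient (fun Wi : EuclideanSpace ℝ (Fin d) =>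
    batchLoss ℓ g c x (Function.update (fun _ => w) i Wi) b) w

/-- Partial derivative of the batch loss with respect to the `i`-th bias, at the evaluation
point where all weight rows equal `w`. -/
def gradB {d B N : ℕ} (ℓ : Fin B → ℝ → ℝ) (g : Fin N → ℝ) (c : ℝ)
    (x : Fin B → EuclideanSpace ℝ (Fin d)) (w : EuclideanSpace ℝ (Fin d))
    (b : Fin N → ℝ) (i : Fin N) : ℝ :=
  deriv (fun t : ℝ => batchLoss ℓ g c x (fun _ => w) (Function.update b i t)) (b i)


theorem aux_relu {z : ℝ} (hz : z ≠ 0) :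
    HasDerivAt (fun t : ℝ => max t 0) (if 0 < z then 1 else 0) z := by
  rcases lt_or_gt_of_ne hz with h | h
  · rw [if_neg (not_lt.mpr h.le)]
    refine (hasDerivAt_const z (0 : ℝ)).congr_of_eventuallyEq ?_
    filter_upwards [gt_mem_nhds h] with t ht
    exact max_eq_right ht.le
  · rw [if_pos h]
    refine (hasDerivAt_id z).congr_of_eventuallyEq ?_
    filter_upwards [lt_mem_nhds h] with t ht
    exact max_eq_left ht.le

theorem aux_netF_W {d N : ℕ} (g : Fin N → ℝ) (c : ℝ)
    (w : EuclideanSpace ℝ (Fin d)) (b : Fin N → ℝ)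
    (y : EuclideanSpace ℝ (Fin d)) (i : Fin N) (v : EuclideanSpace ℝ (Fin d)) :
    netF g c (Function.update (fun _ => w) i v) b y =
      g i * max (⟪v, y⟫ + b i) 0 +
        ((∑ k ∈ Finset.univ.erase i, g k * max (⟪w, y⟫ + b k) 0) + c) := by
  unfold netF
  rw [← Finset.add_sum_erase _ _ (Finset.mem_univ i), Function.update_self, add_assoc]
  congr 2
  refine Finset.sum_congr rfl fun k hk => ?_
  rw [Function.update_of_ne (Finset.ne_of_mem_erase hk)]

theorem aux_netF_b {d N : ℕ} (g : Fin N → ℝ) (c : ℝ)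
    (w : EuclideanSpace ℝ (Fin d)) (b : Fin N → ℝ)
    (y : EuclideanSpace ℝ (Fin d)) (i : Fin N) (t : ℝ) :
    netF g c (fun _ => w) (Function.update b i t) y =
      g i * max (⟪w, y⟫ + t) 0 +
        ((∑ k ∈ Finset.univ.erase i, g k * max (⟪w, y⟫ + b k) 0) + c) := by
  unfold netF
  rw [← Finset.add_sum_erase _ _ (Finset.mem_univ i), Function.update_self, add_assoc]
  congr 2
  refine Finset.sum_congr rfl fun k hk => ?_
  rw [Function.update_of_ne (Finset.ne_of_mem_erase hk)]

theorem aux_gradB {d B N : ℕ}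
    (x : Fin B → EuclideanSpace ℝ (Fin d)) (w : EuclideanSpace ℝ (Fin d))
    (b : Fin N → ℝ) (g : Fin N → ℝ) (c : ℝ)
    (ℓ : Fin B → ℝ → ℝ) (hℓ : ∀ j, Differentiable ℝ (ℓ j))
    (hboundary : ∀ (i : Fin N) (j : Fin B), ⟪w, x j⟫ + b i ≠ 0) (i : Fin N) :
    gradB ℓ g c x w b i = (1 / (B : ℝ)) * ∑ j, sResidual ℓ g c x w b j *
      (g i * if 0 < ⟪w, x j⟫ + b i then 1 else 0) := by
  unfold gradB batchLoss
  refine HasDerivAt.deriv (HasDerivAt.const_mul _ (HasDerivAt.fun_sum fun j _ => ?_))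
  have h1 : HasDerivAt (fun t => netF g c (fun _ => w) (Function.update b i t) (x j))
      (g i * if 0 < ⟪w, x j⟫ + b i then 1 else 0) (b i) := by
    simp_rw [aux_netF_b]
    have h0 : HasDerivAt (fun t : ℝ => ⟪w, x j⟫ + t) 1 (b i) :=
      (hasDerivAt_id (b i)).const_add _
    have h2 := (aux_relu (hboundary i j)).comp (b i) h0
    rw [mul_one] at h2
    exact (h2.const_mul (g i)).add_const _
  have h3 : HasDerivAt (ℓ j) (sResidual ℓ g c x w b j)
      (netF g c (fun _ => w) (Function.update b i (b i)) (x j)) := by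
    rw [Function.update_eq_self]
    exact (hℓ j _).hasDerivAt
  exact h3.comp (b i) h1

theorem aux_gradW {d B N : ℕ}
    (x : Fin B → EuclideanSpace ℝ (Fin d)) (w : EuclideanSpace ℝ (Fin d))
    (b : Fin N → ℝ) (g : Fin N → ℝ) (c : ℝ)
    (ℓ : Fin B → ℝ → ℝ) (hℓ : ∀ j, Differentiable ℝ (ℓ j))
    (hboundary : ∀ (i : Fin N) (j : Fin B), ⟪w, x j⟫ + b i ≠ 0) (i : Fin N) :
    gradW ℓ g c x w b i = (1 / (B : ℝ)) • ∑ j, (sResidual ℓ g c x w b j *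
      (g i * if 0 < ⟪w, x j⟫ + b i then 1 else 0)) • x j := by
  unfold gradW batchLoss
  refine HasGradientAt.gradient ?_
  rw [hasGradientAt_iff_hasFDerivAt, map_smul, map_sum]
  refine HasFDerivAt.const_mul (HasFDerivAt.fun_sum fun j _ => ?_) _
  rw [map_smul]
  have h1 : HasFDerivAt (fun v => netF g c (Function.update (fun _ => w) i v) b (x j))
      ((g i * if 0 < ⟪w, x j⟫ + b i then 1 else 0) •
        (InnerProductSpace.toDual ℝ (EuclideanSpace ℝ (Fin d)) (x j))) w := by
    simp_rw [aux_netF_W]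
    have h0 : HasFDerivAt (fun v : EuclideanSpace ℝ (Fin d) => ⟪v, x j⟫ + b i)
        (InnerProductSpace.toDual ℝ (EuclideanSpace ℝ (Fin d)) (x j) :
          EuclideanSpace ℝ (Fin d) →L[ℝ] ℝ) w := by
      refine HasFDerivAt.add_const _ ?_
      have := (InnerProductSpace.toDual ℝ (EuclideanSpace ℝ (Fin d)) (x j) :
          EuclideanSpace ℝ (Fin d) →L[ℝ] ℝ).hasFDerivAt (x := w)
      refine this.congr_of_eventuallyEq (Filter.Eventually.of_forall fun v => ?_)
      exact real_inner_comm _ _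
    have h2 := (aux_relu (hboundary i j)).comp_hasFDerivAt w h0
    rw [mul_smul]
    exact (h2.const_mul (g i)).add_const _
  have h3 : HasDerivAt (ℓ j) (sResidual ℓ g c x w b j)
      (netF g c (Function.update (fun _ => w) i w) b (x j)) := by
    have : Function.update (fun _ : Fin N => w) i w = fun _ => w :=
      Function.update_eq_self i (fun _ : Fin N => w)
    rw [this]
    exact (hℓ j _).hasDerivAt
  rw [mul_smul]
  exact h3.comp_hasFDerivAt w h1

/-- if the slice `A i' \ A i` contains exactly one sample `j*` with
`r j* ≠ 0`, then the slice scalar `β` is nonzero and the slice vector divided by `β`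
exactly reconstructs the isolated input `x j*`. -/
theorem isolated_sample_reconstruction
    {d B N : ℕ}
    (x : Fin B → EuclideanSpace ℝ (Fin d)) (w : EuclideanSpace ℝ (Fin d))
    (b : Fin N → ℝ) (g : Fin N → ℝ) (c : ℝ)
    (hg : ∀ i, g i ≠ 0)
    (ℓ : Fin B → ℝ → ℝ) (hℓ : ∀ j, Differentiable ℝ (ℓ j))
    (hboundary : ∀ (i : Fin N) (j : Fin B), ⟪w, x j⟫ + b i ≠ 0)
    (i i' : Fin N) (hbb : b i < b i')
    (jstar : Fin B)
    (hslice : activeSet x w b i' \ activeSet x w b i = {jstar})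
    (hr : sResidual ℓ g c x w b jstar ≠ 0) :
    (g i')⁻¹ * gradB ℓ g c x w b i' - (g i)⁻¹ * gradB ℓ g c x w b i ≠ 0 ∧
      ((g i')⁻¹ * gradB ℓ g c x w b i' - (g i)⁻¹ * gradB ℓ g c x w b i)⁻¹ •
          ((g i')⁻¹ • gradW ℓ g c x w b i' - (g i)⁻¹ • gradW ℓ g c x w b i) =
        x jstar := by
  have hs : ∀ j, ((if 0 < ⟪w, x j⟫ + b i' then (1 : ℝ) else 0) -
      (if 0 < ⟪w, x j⟫ + b i then (1 : ℝ) else 0)) = if j = jstar then 1 else 0 := by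
    intro j
    have h : j ∈ activeSet x w b i' \ activeSet x w b i ↔ j = jstar := by
      rw [hslice, Finset.mem_singleton]
    simp only [activeSet, Finset.mem_sdiff, Finset.mem_filter, Finset.mem_univ, true_and] at h
    by_cases hj : j = jstar
    · obtain ⟨h1, h2⟩ := h.mpr hj
      rw [if_pos h1, if_neg h2, if_pos hj, sub_zero]
    · rw [if_neg hj]
      by_cases h2 : 0 < ⟪w, x j⟫ + b i
      · rw [if_pos h2, if_pos (by linarith), sub_self]
      · have h1 : ¬ 0 < ⟪w, x j⟫ + b i' := fun h1 => hj (h.mp ⟨h1, h2⟩)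
        rw [if_neg h1, if_neg h2, sub_self]
  have hc : ∀ j, (g i')⁻¹ * (sResidual ℓ g c x w b j *
        (g i' * if 0 < ⟪w, x j⟫ + b i' then 1 else 0)) -
      (g i)⁻¹ * (sResidual ℓ g c x w b j * (g i * if 0 < ⟪w, x j⟫ + b i then 1 else 0)) =
      if j = jstar then sResidual ℓ g c x w b j else 0 := by
    intro j
    have e : ∀ k (s r : ℝ), (g k)⁻¹ * (r * (g k * s)) = r * s := by
      intro k s r
      have := hg k
      field_simp
    rw [e, e, ← mul_sub, hs j, mul_ite, mul_one, mul_zero]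
  have hβ : (g i')⁻¹ * gradB ℓ g c x w b i' - (g i)⁻¹ * gradB ℓ g c x w b i =
      (1 / (B : ℝ)) * sResidual ℓ g c x w b jstar := by
    rw [aux_gradB x w b g c ℓ hℓ hboundary, aux_gradB x w b g c ℓ hℓ hboundary,
      mul_left_comm, mul_left_comm (g i)⁻¹, ← mul_sub, Finset.mul_sum, Finset.mul_sum,
      ← Finset.sum_sub_distrib, Finset.sum_congr rfl fun j _ => hc j]
    simp
  have hV : (g i')⁻¹ • gradW ℓ g c x w b i' - (g i)⁻¹ • gradW ℓ g c x w b i =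
      ((1 / (B : ℝ)) * sResidual ℓ g c x w b jstar) • x jstar := by
    rw [aux_gradW x w b g c ℓ hℓ hboundary, aux_gradW x w b g c ℓ hℓ hboundary,
      smul_comm, smul_comm (g i)⁻¹, ← smul_sub, Finset.smul_sum, Finset.smul_sum,
      ← Finset.sum_sub_distrib]
    simp_rw [smul_smul (g i')⁻¹, smul_smul (g i)⁻¹, ← sub_smul, hc]
    simp [ite_smul, smul_smul]
  have hB : (B : ℝ) ≠ 0 := by
    have := jstar.pos
    positivity
  have hne : (1 / (B : ℝ)) * sResidual ℓ g c x w b jstar ≠ 0 :=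
    mul_ne_zero (one_div_ne_zero hB) hr
  rw [hβ, hV]
  exact ⟨hne, inv_smul_smul₀ hne _⟩

end
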